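/- arXiv:1211.6646 — 2 statements merged into one kernel-verified Lean document; each statement's English description precedes it below -/
import Mathlib

section
/- Let A_1, …, A_r ∈ A. Then ∑_{σ ∈ S_r} (ǎd(A_{σ(1)}) ∘ ǎd(A_{σ(2)}) ∘ ⋯ ∘ ǎd(A_{σ(r)}))(1) = 2^r · ∑_{σ ∈ S_r} A_{σ(1)} A_{σ(2)} ⋯ A_{σ(r)}, where S_r is the symmetric group on r letters and the composition on the left is taken in End_ℚ(A) and applied to the unit 1 ∈ A. -/
open Finset Equiv

/-- `adCheck a = L_a + R_a ∈ End_ℚ(A)`, the sum of left and right multiplication by `a`. -/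
def adCheck {A : Type*} [Ring A] [Algebra ℚ A] (a : A) : Module.End ℚ A :=
  LinearMap.mulLeft ℚ a + LinearMap.mulRight ℚ a

/-- Noncommutative polarization: the sum of the products of `a 0, …, a (r - 1)` over all orders is
an alternating sum of `r`-th powers of partial sums. -/
theorem sum_perm_prod_ofFn_eq_sum_powerset {B : Type*} [Ring B] (r : ℕ) (a : Fin r → B) :
    ∑ σ : Perm (Fin r), (List.ofFn fun i => a (σ i)).prod =
      ∑ t ∈ (univ : Finset (Fin r)).powerset, (-1 : ℤ) ^ #t • (∑ i ∈ tᶜ, a i) ^ r := by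
  have h := inclusion_exclusion_sum_inf_compl univ
    (fun i : Fin r => ({f | ∀ j, f j ≠ i} : Finset (Fin r → Fin r)))
    (fun f => (List.ofFn fun i => a (f i)).prod)
  have h_pow (t : Finset (Fin r)) :
      ∑ f ∈ t.inf (fun i : Fin r => ({f | ∀ j, f j ≠ i} : Finset (Fin r → Fin r))),
        (List.ofFn fun i => a (f i)).prod = (∑ i ∈ tᶜ, a i) ^ r := by
    have h_inf : t.inf (fun i : Fin r => ({f | ∀ j, f j ≠ i} : Finset (Fin r → Fin r))) =
        Fintype.piFinset fun _ => tᶜ := by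
      ext f
      simp only [mem_inf, mem_filter, mem_univ, true_and, Fintype.mem_piFinset, mem_compl]
      grind
    have h_sum := (MultilinearMap.mkPiAlgebraFin ℤ r B).map_sum_finset
      (fun _ i => a i) (fun _ => tᶜ)
    simp only [MultilinearMap.mkPiAlgebraFin_apply, List.ofFn_const, List.prod_replicate] at h_sum
    rw [h_inf, h_sum]
  simp only [h_pow] at h
  rw [← h]
  refine sum_bij (fun σ _ => ⇑σ) (fun σ _ => ?_) (fun _ _ _ _ h => DFunLike.coe_injective h)
    (fun f hf => ?_) (fun _ _ => rfl)
  · simpa [mem_inf, Function.Surjective] using σ.surjective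
  · have hf : Function.Surjective f := by simpa [mem_inf, Function.Surjective] using hf
    exact ⟨Equiv.ofBijective f (Finite.surjective_iff_bijective.mp hf), mem_univ _, rfl⟩

theorem adCheck_sum {A ι : Type*} [Ring A] [Algebra ℚ A] (s : Finset ι) (a : ι → A) :
    adCheck (∑ i ∈ s, a i) = ∑ i ∈ s, adCheck (a i) := by
  ext x
  simp [adCheck, sum_mul, mul_sum, sum_add_distrib, LinearMap.sum_apply]

theorem adCheck_pow_apply_one {A : Type*} [Ring A] [Algebra ℚ A] (a : A) (n : ℕ) :
    (adCheck a ^ n) 1 = (2 : A) ^ n * a ^ n := by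
  induction n with
  | zero => simp
  | succ n ih =>
    have h : a * 2 ^ n = 2 ^ n * a := ((Commute.ofNat_right a 2).pow_right n).eq
    rw [pow_succ', Module.End.mul_apply, ih]
    simp only [adCheck, LinearMap.add_apply, LinearMap.mulLeft_apply, LinearMap.mulRight_apply]
    rw [← mul_assoc, h, mul_assoc, mul_assoc, ← pow_succ', ← pow_succ, ← two_mul, ← mul_assoc,
      ← pow_succ']


/-- For `A_1, …, A_r ∈ A`:
`∑_{σ ∈ S_r} (ǎd(A_{σ(1)}) ∘ ⋯ ∘ ǎd(A_{σ(r)}))(1) = 2^r ∑_{σ ∈ S_r} A_{σ(1)} ⋯ A_{σ(r)}`,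
the composition on the left being taken in `End_ℚ(A)` and applied to `1 ∈ A`. -/
theorem adCheck_permSum_apply_one {A : Type*} [Ring A] [Algebra ℚ A] (r : ℕ)
    (As : Fin r → A) :
    (∑ σ : Perm (Fin r), ((List.ofFn fun i => adCheck (As (σ i))).prod) 1) =
    (2 : A) ^ r * ∑ σ : Perm (Fin r), (List.ofFn fun i => As (σ i)).prod := by
  rw [← LinearMap.sum_apply, sum_perm_prod_ofFn_eq_sum_powerset r fun i => adCheck (As i),
    sum_perm_prod_ofFn_eq_sum_powerset, LinearMap.sum_apply, mul_sum]
  refine sum_congr rfl fun t _ => ?_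
  rw [LinearMap.smul_apply, ← adCheck_sum, adCheck_pow_apply_one, mul_smul_comm]
end

section
/- For every natural number l, p^l q^l = ((1+T)/2)_l and q^l p^l = (−1)^l · ((1−T)/2)_l in A. -/
open Polynomial

theorem mul_mul_pow_eq_of_commutator_eq_one {A : Type*} [Ring A] {p q : A}
    (hpq : p * q - q * p = 1) (l : ℕ) : p * q * q ^ l = q ^ l * (p * q + l) := by
  induction l with
  | zero => simp
  | succ l ih =>
    have hcomm : p * q * q = q * (p * q + 1) := by
      calc p * q * q = q * p * q + (p * q - q * p) * q := by noncomm_ring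
        _ = q * (p * q + 1) := by rw [hpq, mul_add, one_mul, mul_one, mul_assoc]
    calc p * q * q ^ (l + 1) = p * q * q ^ l * q := by rw [pow_succ, mul_assoc (p * q)]
      _ = q ^ l * (p * q * q + l * q) := by rw [ih, mul_assoc, add_mul]
      _ = q ^ l * (q * (p * q + 1) + q * l) := by rw [hcomm, Nat.cast_comm]
      _ = q ^ (l + 1) * (p * q + (l + 1 : ℕ)) := by
        rw [← mul_add, ← mul_assoc, ← pow_succ, Nat.cast_succ, add_assoc, add_comm 1 (l : A)]

theorem pow_mul_pow_eq_ascPochhammer_eval_mul {A : Type*} [Ring A] {p q : A}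
    (hpq : p * q - q * p = 1) (l : ℕ) :
    p ^ l * q ^ l = (ascPochhammer A l).eval (p * q) := by
  induction l with
  | zero => simp
  | succ l ih =>
    rw [ascPochhammer_succ_eval, ← ih, mul_assoc, ← mul_mul_pow_eq_of_commutator_eq_one hpq,
      pow_succ, pow_succ']
    simp only [mul_assoc]

/-- For `p, q` in a `ℚ`-algebra `A` with `p*q - q*p = 1`, `T = pq + qp`
and every `l ∈ ℕ`:
`p^l q^l = ((1+T)/2)_l` and `q^l p^l = (-1)^l ((1-T)/2)_l`,
where `(a)_l` is the ascending factorial (evaluation of `ascPochhammer A l` at `a`). -/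
theorem pow_mul_pow_eq_ascPochhammer {A : Type*} [Ring A] [Algebra ℚ A] (p q : A)
    (hpq : p * q - q * p = 1) (T : A) (hT : T = p * q + q * p) (l : ℕ) :
    p ^ l * q ^ l = (ascPochhammer A l).eval ((1 / 2 : ℚ) • (1 + T)) ∧
    q ^ l * p ^ l = (-1 : A) ^ l * (ascPochhammer A l).eval ((1 / 2 : ℚ) • (1 - T)) := by
  have half_smul_add_self (a : A) : (1 / 2 : ℚ) • (a + a) = a := by
    rw [← two_smul ℚ a, smul_smul]
    norm_num
  have h₁ : (1 / 2 : ℚ) • (1 + T) = p * q := by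
    have h : 1 + T = p * q + p * q := by
      rw [hT, ← hpq]
      abel
    rw [h, half_smul_add_self]
  have h₂ : (1 / 2 : ℚ) • (1 - T) = q * -p := by
    have h : 1 - T = q * -p + q * -p := by
      rw [hT, ← hpq, mul_neg]
      abel
    rw [h, half_smul_add_self]
  have hqp : q * -p - -p * q = 1 := by
    rw [← hpq]
    noncomm_ring
  refine ⟨h₁ ▸ pow_mul_pow_eq_ascPochhammer_eval_mul hpq l, ?_⟩
  rw [h₂, ← pow_mul_pow_eq_ascPochhammer_eval_mul hqp, neg_pow p, ← mul_assoc, ← mul_assoc,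
    mul_assoc _ (q ^ l), ((Commute.neg_one_right (q ^ l)).pow_right l).eq, ← mul_assoc,
    ← (Commute.refl (-1 : A)).mul_pow, neg_one_mul, neg_neg, one_pow, one_mul]
end
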